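/- arXiv:2208.12478 — 2 statements merged into one kernel-verified Lean document; each statement's English description precedes it below -/
import Mathlib

section
/- For an odd prime p, the Hilbert symbol on Q_p satisfies: for all a, b in Q_p^×, (a,b) = ω((-1)^{v(a)v(b)} · b^{v(a)} / a^{v(b)})^{(p-1)/2}, where v is the p-adic valuation and ω is the projection Q_p^× → F_p^× onto the torsion part (composed with the Teichmüller lift). In particular, the Hilbert symbol is symmetric: (a,b) = (b,a) for all a,b ∈ Q_p^×. -/
open scoped Classical

/-- The "unit part" `x · p^{-v(x)}` of a nonzero `p`-adic number. -/
noncomputable def unitPart (p : ℕ) [Fact p.Prime] (x : ℚ_[p]) : ℚ_[p] :=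
  x * (p : ℚ_[p]) ^ (-x.valuation)

/-- The projection `ω : ℚ_p^× → F_p^×` onto the torsion part (via the Teichmüller lift):
`ω(x)` is the residue of the unit part of `x`. -/
noncomputable def omegaVal (p : ℕ) [Fact p.Prime] (x : ℚ_[p]) : ZMod p :=
  if h : ‖unitPart p x‖ ≤ 1 then PadicInt.toZMod (⟨unitPart p x, h⟩ : ℤ_[p]) else 0

/-- The explicit formula `ω((-1)^{v(a)v(b)} · b^{v(a)} / a^{v(b)})^{(p-1)/2}` for the
degree-two Hilbert symbol on `ℚ_p` (valued in `μ₂ = {±1} ⊆ F_p^×`). -/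
noncomputable def hilbertFormula (p : ℕ) [Fact p.Prime] (a b : ℚ_[p]) : ZMod p :=
  omegaVal p ((-1 : ℚ_[p]) ^ (a.valuation * b.valuation) * b ^ a.valuation / a ^ b.valuation) ^
    ((p - 1) / 2)


section Helpers

variable {p : ℕ} [Fact p.Prime]

lemma hs_p_ne : (p : ℚ_[p]) ≠ 0 := Nat.cast_ne_zero.mpr (Fact.out : p.Prime).ne_zero

lemma hs_norm_unitPart {x : ℚ_[p]} (hx : x ≠ 0) : ‖unitPart p x‖ = 1 := by
  have hp0 : (p : ℝ) ≠ 0 := Nat.cast_ne_zero.mpr (Fact.out : p.Prime).ne_zero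
  unfold unitPart
  rw [norm_mul, norm_zpow, Padic.norm_p, Padic.norm_eq_zpow_neg_valuation hx, inv_zpow,
    ← zpow_neg, ← zpow_add₀ hp0]
  simp

lemma hs_omega_eq {x : ℚ_[p]} (hx : x ≠ 0) :
    omegaVal p x = PadicInt.toZMod (⟨unitPart p x, (hs_norm_unitPart hx).le⟩ : ℤ_[p]) := by
  unfold omegaVal
  rw [dif_pos]

lemma hs_unitPart_mul {x y : ℚ_[p]} (hx : x ≠ 0) (hy : y ≠ 0) :
    unitPart p (x * y) = unitPart p x * unitPart p y := by
  unfold unitPart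
  rw [Padic.valuation_mul hx hy, neg_add, zpow_add₀ hs_p_ne]
  ring

lemma hs_omega_mul {x y : ℚ_[p]} (hx : x ≠ 0) (hy : y ≠ 0) :
    omegaVal p (x * y) = omegaVal p x * omegaVal p y := by
  rw [hs_omega_eq hx, hs_omega_eq hy, hs_omega_eq (mul_ne_zero hx hy)]
  refine Eq.trans ?_ (map_mul PadicInt.toZMod _ _)
  congr 1
  apply Subtype.ext
  exact hs_unitPart_mul hx hy

lemma hs_val_zero {x : ℚ_[p]} (hx : ‖x‖ = 1) : x.valuation = 0 := by
  have hx0 : x ≠ 0 := by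
    rintro rfl
    simp at hx
  have h1 : (1 : ℝ) < p := by exact_mod_cast (Fact.out : p.Prime).one_lt
  rw [Padic.norm_eq_zpow_neg_valuation hx0] at hx
  have := (zpow_eq_one_iff_right₀ (by linarith) (by linarith)).mp hx
  omega

lemma hs_omega_coe {z : ℤ_[p]} (hz : ‖z‖ = 1) : omegaVal p (z : ℚ_[p]) = PadicInt.toZMod z := by
  have hz' : ‖(z : ℚ_[p])‖ = 1 := by simpa using hz
  have hx0 : (z : ℚ_[p]) ≠ 0 := by
    intro h
    rw [h] at hz'
    simp at hz'
  rw [hs_omega_eq hx0]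
  congr 1
  apply Subtype.ext
  simp [unitPart, hs_val_zero hz']

lemma hs_toZMod_ne {z : ℤ_[p]} : PadicInt.toZMod z ≠ 0 ↔ ‖z‖ = 1 := by
  rw [← PadicInt.isUnit_iff, Ne, ← RingHom.mem_ker, PadicInt.ker_toZMod,
    IsLocalRing.mem_maximalIdeal, mem_nonunits_iff, not_not]

lemma hs_omega_ne {x : ℚ_[p]} (hx : x ≠ 0) : omegaVal p x ≠ 0 := by
  rw [hs_omega_eq hx]
  exact hs_toZMod_ne.mpr (hs_norm_unitPart hx)

lemma hs_omega_p : omegaVal p (p : ℚ_[p]) = 1 := by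
  rw [hs_omega_eq hs_p_ne, ← map_one PadicInt.toZMod]
  congr 1
  apply Subtype.ext
  have := hs_p_ne (p := p)
  simp [unitPart, this]

/-- The quadratic character of the residue of the unit part. -/
noncomputable def hsChi (p : ℕ) [Fact p.Prime] (x : ℚ_[p]) : ZMod p :=
  omegaVal p x ^ ((p - 1) / 2)

lemma hs_half (hp : Odd p) : (p - 1) / 2 = p / 2 := by
  obtain ⟨k, hk⟩ := hp
  omega

lemma hs_chi_val (hp : Odd p) {x : ℚ_[p]} (hx : x ≠ 0) : hsChi p x = 1 ∨ hsChi p x = -1 := by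
  unfold hsChi
  rw [hs_half hp]
  exact ZMod.pow_div_two_eq_neg_one_or_one p (hs_omega_ne hx)

lemma hs_chi_mul {x y : ℚ_[p]} (hx : x ≠ 0) (hy : y ≠ 0) :
    hsChi p (x * y) = hsChi p x * hsChi p y := by
  unfold hsChi
  rw [hs_omega_mul hx hy, mul_pow]

lemma hs_neg_one_ne (hp : Odd p) : (-1 : ZMod p) ≠ 1 := by
  have : Fact (2 < p) := ⟨by
    have := (Fact.out : p.Prime).two_le
    obtain ⟨k, hk⟩ := hp
    omega⟩
  exact ZMod.neg_one_ne_one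

lemma hs_two_unit (hp : Odd p) : ‖(2 : ℤ_[p])‖ = 1 := by
  rw [← hs_toZMod_ne]
  intro h
  apply hs_neg_one_ne hp
  have h2 : (2 : ZMod p) = 0 := by rwa [map_ofNat] at h
  linear_combination -h2

lemma hs_square (hp : Odd p) {u : ℚ_[p]} (hu : ‖u‖ = 1) (hc : hsChi p u = 1) :
    ∃ c : ℚ_[p], c ≠ 0 ∧ u = c ^ 2 := by
  obtain ⟨z, rfl⟩ : ∃ z : ℤ_[p], (z : ℚ_[p]) = u := ⟨⟨u, hu.le⟩, rfl⟩
  have hz : ‖z‖ = 1 := by simpa using hu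
  unfold hsChi at hc
  rw [hs_omega_coe hz, hs_half hp, ← ZMod.euler_criterion p (hs_toZMod_ne.mpr hz)] at hc
  obtain ⟨r, hr⟩ := hc
  obtain ⟨a, rfl⟩ := ZMod.ringHom_surjective (PadicInt.toZMod (p := p)) r
  have ha : ‖a‖ = 1 := by
    rw [← hs_toZMod_ne]
    intro h
    rw [h] at hr
    exact hs_toZMod_ne.mpr hz (by simpa using hr)
  have hlt : ‖a ^ 2 - z‖ < 1 := by
    refine lt_of_le_of_ne (PadicInt.norm_le_one _) ?_
    rw [Ne, ← hs_toZMod_ne, not_not, map_sub, map_pow, hr]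
    ring
  have hn : ‖2 * a‖ = 1 := by rw [norm_mul, hs_two_unit hp, ha, one_mul]
  obtain ⟨c, hc, -⟩ := hensels_lemma (p := p) (R := ℤ_[p])
    (F := Polynomial.X ^ 2 - Polynomial.C z) (a := a) (by
      have e : (Polynomial.X ^ 2 - Polynomial.C z).derivative.aeval a = 2 * a := by
        simp [Polynomial.derivative_X_pow, one_add_one_eq_two]
      rw [e, hn]
      simpa using hlt)
  have hc' : z = c ^ 2 := by
    simp at hc
    linear_combination -hc
  refine ⟨c, ?_, by rw [hc']; push_cast; ring⟩
  intro h0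
  have : c = 0 := PadicInt.coe_eq_zero.mp h0
  rw [hc', this] at hz
  simp at hz

lemma hs_zpow {f : ℚ_[p] → ZMod p} (hf : ∀ x, x ≠ 0 → f x ≠ 0)
    (hm : ∀ x y, x ≠ 0 → y ≠ 0 → f (x * y) = f x * f y) {x : ℚ_[p]} (hx : x ≠ 0) (n : ℤ) :
    f (x ^ n) = f x ^ n := by
  have h1 : f 1 = 1 := by
    have := hm 1 1 one_ne_zero one_ne_zero
    rw [mul_one] at this
    exact mul_left_cancel₀ (hf 1 one_ne_zero) (by rw [← this, mul_one])
  induction n using Int.induction_on with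
  | zero => simpa using h1
  | succ n ih => rw [zpow_add_one₀ hx, zpow_add_one₀ (hf x hx), hm _ _ (zpow_ne_zero _ hx) hx, ih]
  | pred n ih =>
    apply mul_right_cancel₀ (hf x hx)
    rw [← hm _ _ (zpow_ne_zero _ hx) hx, ← zpow_add_one₀ hx, ← zpow_add_one₀ (hf x hx)]
    simpa using ih

/-- Factorisation into a power of `p` and a unit. -/
lemma hs_factor {x : ℚ_[p]} (hx : x ≠ 0) : x = (p : ℚ_[p]) ^ x.valuation * unitPart p x := by
  have := zpow_ne_zero x.valuation (hs_p_ne (p := p))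
  unfold unitPart
  rw [zpow_neg]
  field_simp

lemma hs_chi_unitPart {x : ℚ_[p]} (hx : x ≠ 0) : hsChi p (unitPart p x) = hsChi p x := by
  have hn := hs_norm_unitPart hx
  have : omegaVal p (unitPart p x) = omegaVal p x := by
    rw [hs_omega_eq hx]
    exact hs_omega_coe (z := ⟨unitPart p x, hn.le⟩) hn
  unfold hsChi
  rw [this]

lemma hs_formula (hp : Odd p) {a b : ℚ_[p]} (ha : a ≠ 0) (hb : b ≠ 0) :
    hilbertFormula p a b = hsChi p (-1) ^ (a.valuation * b.valuation) *
      hsChi p b ^ a.valuation * hsChi p a ^ b.valuation := by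
  have hf : ∀ x : ℚ_[p], x ≠ 0 → hsChi p x ≠ 0 := fun x hx => pow_ne_zero _ (hs_omega_ne hx)
  have hm := fun (x y : ℚ_[p]) hx hy => hs_chi_mul (x := x) (y := y) hx hy
  have h1 : (-1 : ℚ_[p]) ≠ 0 := by simp
  change hsChi p _ = _
  rw [div_eq_mul_inv, ← zpow_neg,
    hm _ _ (mul_ne_zero (zpow_ne_zero _ h1) (zpow_ne_zero _ hb)) (zpow_ne_zero _ ha),
    hm _ _ (zpow_ne_zero _ h1) (zpow_ne_zero _ hb), hs_zpow hf hm h1, hs_zpow hf hm hb,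
    hs_zpow hf hm ha]
  congr 1
  rw [zpow_neg, ← inv_zpow]
  rcases hs_chi_val hp ha with h | h <;> rw [h] <;> norm_num

end Helpers

/-- For an odd prime `p`, the Hilbert symbol `(-,-) : ℚ_p^× × ℚ_p^× → μ₂` (characterized as the
non-degenerate bimultiplicative pairing with kernel the squares in each variable, satisfying the
Steinberg relation `(a, 1-a) = 1`, coming from local class field theory and Kummer theory)
satisfies `(a,b) = ω((-1)^{v(a)v(b)} b^{v(a)}/a^{v(b)})^{(p-1)/2}`; in particular it is
symmetric. -/
theorem statement0 (p : ℕ) [Fact p.Prime] (hp : Odd p)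
    (h : ℚ_[p] → ℚ_[p] → ZMod p)
    (hval : ∀ a b : ℚ_[p], a ≠ 0 → b ≠ 0 → h a b = 1 ∨ h a b = -1)
    (hmul_left : ∀ a a' b : ℚ_[p], a ≠ 0 → a' ≠ 0 → b ≠ 0 →
      h (a * a') b = h a b * h a' b)
    (hmul_right : ∀ a b b' : ℚ_[p], a ≠ 0 → b ≠ 0 → b' ≠ 0 →
      h a (b * b') = h a b * h a b')
    (hker_left : ∀ a : ℚ_[p], a ≠ 0 →
      ((∀ b : ℚ_[p], b ≠ 0 → h a b = 1) ↔ ∃ c : ℚ_[p], c ≠ 0 ∧ a = c ^ 2))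
    (hker_right : ∀ b : ℚ_[p], b ≠ 0 →
      ((∀ a : ℚ_[p], a ≠ 0 → h a b = 1) ↔ ∃ c : ℚ_[p], c ≠ 0 ∧ b = c ^ 2))
    (hsteinberg : ∀ a : ℚ_[p], a ≠ 0 → a ≠ 1 → h a (1 - a) = 1) :
    (∀ a b : ℚ_[p], a ≠ 0 → b ≠ 0 → h a b = hilbertFormula p a b) ∧
    (∀ a b : ℚ_[p], a ≠ 0 → b ≠ 0 → h a b = h b a) := by
  have hnn := hs_neg_one_ne hp
  have hp0 : (p : ℚ_[p]) ≠ 0 := hs_p_ne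
  have hne : ∀ a b : ℚ_[p], a ≠ 0 → b ≠ 0 → h a b ≠ 0 := by
    intro a b ha hb
    rcases hval a b ha hb with h1 | h1 <;> rw [h1] <;> simp
  have hsql : ∀ a b : ℚ_[p], a ≠ 0 → b ≠ 0 → ‖a‖ = 1 → hsChi p a = 1 → h a b = 1 :=
    fun a b ha hb hn hc => (hker_left a ha).mpr (hs_square hp hn hc) b hb
  have hsqr : ∀ a b : ℚ_[p], a ≠ 0 → b ≠ 0 → ‖b‖ = 1 → hsChi p b = 1 → h a b = 1 :=
    fun a b ha hb hn hc => (hker_right b hb).mpr (hs_square hp hn hc) a ha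
  have hn0 : ∀ u : ℚ_[p], ‖u‖ = 1 → u ≠ 0 := by
    rintro u hu rfl
    simp at hu
  -- the symbol is trivial on units
  have huu : ∀ u w : ℚ_[p], ‖u‖ = 1 → ‖w‖ = 1 → h u w = 1 := by
    intro u w hu hw
    have hu0 := hn0 u hu
    have hw0 := hn0 w hw
    rcases hs_chi_val hp hu0 with hcu | hcu
    · exact hsql u w hu0 hw0 hu hcu
    rcases hs_chi_val hp hw0 with hcw | hcw
    · exact hsqr u w hu0 hw0 hw hcw
    obtain ⟨z, rfl⟩ : ∃ z : ℤ_[p], (z : ℚ_[p]) = u := ⟨⟨u, hu.le⟩, rfl⟩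
    have hz : ‖z‖ = 1 := by simpa using hu
    have hzne := hs_toZMod_ne.mpr hz
    have hnsq : ¬ IsSquare (PadicInt.toZMod z) := by
      rw [ZMod.euler_criterion p hzne, ← hs_half hp, ← hs_omega_coe hz]
      change ¬ hsChi p _ = 1
      rw [hcu]
      exact hnn
    obtain ⟨x, y, hxy⟩ := ZMod.sq_add_sq p (PadicInt.toZMod z)⁻¹
    have hx : x ≠ 0 := by
      rintro rfl
      apply hnsq
      refine ⟨y⁻¹, ?_⟩
      rw [← inv_inv (PadicInt.toZMod z), ← hxy, ← mul_inv]
      congr 1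
      ring
    have hy : y ≠ 0 := by
      rintro rfl
      apply hnsq
      refine ⟨x⁻¹, ?_⟩
      rw [← inv_inv (PadicInt.toZMod z), ← hxy, ← mul_inv]
      congr 1
      ring
    obtain ⟨A, rfl⟩ := ZMod.ringHom_surjective (PadicInt.toZMod (p := p)) x
    have hA : ‖A‖ = 1 := hs_toZMod_ne.mp hx
    have hA0 : (A : ℚ_[p]) ≠ 0 := hn0 _ (by simpa using hA)
    have hres : PadicInt.toZMod (1 - z * A ^ 2) = PadicInt.toZMod z * y ^ 2 := by
      rw [map_sub, map_one, map_mul, map_pow]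
      have := mul_inv_cancel₀ hzne
      rw [← hxy] at this
      linear_combination -this
    have ht : ‖1 - z * A ^ 2‖ = 1 := by
      rw [← hs_toZMod_ne, hres]
      exact mul_ne_zero hzne (pow_ne_zero _ hy)
    have ht' : ‖((1 - z * A ^ 2 : ℤ_[p]) : ℚ_[p])‖ = 1 := by
      rw [← PadicInt.norm_def]; exact ht
    have ht0 := hn0 _ ht'
    have hct : hsChi p ((1 - z * A ^ 2 : ℤ_[p]) : ℚ_[p]) = -1 := by
      rw [← hcu]
      unfold hsChi
      rw [hs_omega_coe ht, hs_omega_coe hz, hres, mul_pow, ← pow_mul,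
        show 2 * ((p - 1) / 2) = p - 1 by obtain ⟨k, hk⟩ := hp; omega,
        ZMod.pow_card_sub_one_eq_one hy, mul_one]
    have hst : h ((z : ℚ_[p]) * (A * A)) ((1 - z * A ^ 2 : ℤ_[p]) : ℚ_[p]) = 1 := by
      have := hsteinberg ((z : ℚ_[p]) * (A * A)) (mul_ne_zero hu0 (mul_ne_zero hA0 hA0)) (by
        intro h1
        apply ht0
        push_cast
        linear_combination -h1)
      convert this using 2
      push_cast
      ring
    rw [hmul_left _ _ _ hu0 (mul_ne_zero hA0 hA0) ht0, hmul_left _ _ _ hA0 hA0 ht0] at hst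
    have hAA : h A ((1 - z * A ^ 2 : ℤ_[p]) : ℚ_[p]) * h A ((1 - z * A ^ 2 : ℤ_[p]) : ℚ_[p]) = 1 := by
      rcases hval _ _ hA0 ht0 with h1 | h1 <;> rw [h1] <;> norm_num
    rw [hAA, mul_one] at hst
    have hfin := hsqr z (((1 - z * A ^ 2 : ℤ_[p]) : ℚ_[p]) * w) hu0 (mul_ne_zero ht0 hw0)
      (by rw [norm_mul, ht', hw, one_mul])
      (by rw [hs_chi_mul ht0 hw0, hct, hcw]; norm_num)
    rw [hmul_right _ _ _ hu0 ht0 hw0, hst, one_mul] at hfin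
    exact hfin
  have hzl : ∀ (b : ℚ_[p]), b ≠ 0 → ∀ (x : ℚ_[p]), x ≠ 0 → ∀ n : ℤ, h (x ^ n) b = h x b ^ n :=
    fun b hb x hx n => hs_zpow (f := fun x => h x b) (fun x hx => hne x b hx hb)
      (fun x y hx hy => hmul_left x y b hx hy hb) hx n
  have hzr : ∀ (b : ℚ_[p]), b ≠ 0 → ∀ (x : ℚ_[p]), x ≠ 0 → ∀ n : ℤ, h b (x ^ n) = h b x ^ n :=
    fun b hb x hx n => hs_zpow (f := fun x => h b x) (fun x hx => hne b x hb hx)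
      (fun x y hx hy => hmul_right b x y hb hx hy) hx n
  have hU : ∀ x : ℚ_[p], x ≠ 0 → unitPart p x ≠ 0 := fun x hx => hn0 _ (hs_norm_unitPart hx)
  have hnsq : ∀ u : ℚ_[p], u ≠ 0 → hsChi p u = -1 → ¬ ∃ c : ℚ_[p], c ≠ 0 ∧ u = c ^ 2 := by
    rintro u hu hc ⟨c, hc0, rfl⟩
    rw [pow_two, hs_chi_mul hc0 hc0] at hc
    apply hnn
    rw [← hc]
    rcases hs_chi_val hp hc0 with h1 | h1 <;> rw [h1] <;> norm_num
  have hpu : ∀ u : ℚ_[p], ‖u‖ = 1 → h p u = hsChi p u := by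
    intro u hu
    have hu0 := hn0 u hu
    rcases hs_chi_val hp hu0 with hc | hc
    · rw [hc]; exact hsqr _ _ hp0 hu0 hu hc
    rcases hval p u hp0 hu0 with h1 | h1
    · exfalso
      apply hnsq u hu0 hc
      rw [← hker_right u hu0]
      intro a ha
      rw [hs_factor ha, hmul_left _ _ _ (zpow_ne_zero _ hp0) (hU a ha) hu0, hzl u hu0 p hp0, h1,
        huu _ _ (hs_norm_unitPart ha) hu]
      simp
    · rw [h1, hc]
  have hup : ∀ u : ℚ_[p], ‖u‖ = 1 → h u p = hsChi p u := by
    intro u hu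
    have hu0 := hn0 u hu
    rcases hs_chi_val hp hu0 with hc | hc
    · rw [hc]; exact hsql _ _ hu0 hp0 hu hc
    rcases hval u p hu0 hp0 with h1 | h1
    · exfalso
      apply hnsq u hu0 hc
      rw [← hker_left u hu0]
      intro a ha
      rw [hs_factor ha, hmul_right _ _ _ hu0 (zpow_ne_zero _ hp0) (hU a ha), hzr u hu0 p hp0, h1,
        huu _ _ hu (hs_norm_unitPart ha)]
      simp
    · rw [h1, hc]
  have hpp : h p p = hsChi p (-1) := by
    have hp1 : (p : ℚ_[p]) ≠ 1 := by exact_mod_cast (Fact.out : p.Prime).ne_one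
    have hi0 : (p : ℚ_[p])⁻¹ ≠ 0 := inv_ne_zero hp0
    have hi1 : (p : ℚ_[p])⁻¹ ≠ 1 := by simpa using hp1
    have hq0 : 1 - (p : ℚ_[p])⁻¹ ≠ 0 := sub_ne_zero.mpr hi1.symm
    have e1 := hsteinberg p hp0 hp1
    have e2 := hsteinberg _ hi0 hi1
    have e3 : h p (1 - (p : ℚ_[p])⁻¹) = 1 := by
      have := hzl _ hq0 p hp0 (-1)
      rw [zpow_neg_one, e2, zpow_neg_one] at this
      exact inv_eq_one.mp this.symm
    have e4 : 1 - (p : ℚ_[p]) = (-1) * p * (1 - (p : ℚ_[p])⁻¹) := by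
      field_simp
      ring
    have hm1 : (-1 : ℚ_[p]) ≠ 0 := by simp
    rw [e4, hmul_right _ _ _ hp0 (mul_ne_zero hm1 hp0) hq0, e3, mul_one,
      hmul_right _ _ _ hp0 hm1 hp0, hpu (-1) (by simp)] at e1
    rcases hs_chi_val hp hm1 with h1 | h1 <;> rw [h1] at e1 ⊢
    · simpa using e1
    · linear_combination -e1
  have main : ∀ a b : ℚ_[p], a ≠ 0 → b ≠ 0 → h a b = hsChi p (-1) ^ (a.valuation * b.valuation) *
      hsChi p b ^ a.valuation * hsChi p a ^ b.valuation := by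
    intro a b ha hb
    have hza := zpow_ne_zero a.valuation hp0
    have hzb := zpow_ne_zero b.valuation hp0
    have e1 : h ((p : ℚ_[p]) ^ a.valuation) b = hsChi p (-1) ^ (a.valuation * b.valuation) *
      hsChi p b ^ a.valuation := by
      rw [hzl b hb p hp0]
      have : h p b = hsChi p (-1) ^ b.valuation * hsChi p b := by
        conv_lhs => rw [hs_factor hb]
        rw [hmul_right _ _ _ hp0 hzb (hU b hb), hzr p hp0 p hp0, hpp,
          hpu _ (hs_norm_unitPart hb), hs_chi_unitPart hb]
      rw [this, mul_zpow, ← zpow_mul, mul_comm b.valuation]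
    have e2 : h (unitPart p a) b = hsChi p a ^ b.valuation := by
      conv_lhs => rw [hs_factor hb]
      rw [hmul_right _ _ _ (hU a ha) hzb (hU b hb), hzr _ (hU a ha) p hp0,
        hup _ (hs_norm_unitPart ha), huu _ _ (hs_norm_unitPart ha) (hs_norm_unitPart hb),
        hs_chi_unitPart ha, mul_one]
    conv_lhs => rw [hs_factor ha]
    rw [hmul_left _ _ _ hza (hU a ha) hb, e1, e2]
  refine ⟨fun a b ha hb => ?_, fun a b ha hb => ?_⟩
  · rw [main a b ha hb, hs_formula hp ha hb]
  · rw [main a b ha hb, main b a hb ha, mul_comm b.valuation]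
    ring
end

section
/- Let k be an algebraically closed field of characteristic p and H(1) the k-algebra with central invertible generator T and generators S₀, S₁ satisfying S₀² = -S₀, S₁² = 0 (with basis as in the pro-p Iwahori Hecke algebra of the trivial character). Then the simple right H(1)-modules are, up to isomorphism: (SS) for each (λ,z) ∈ {0,-1} × k^×, the character T ↦ z, S₁ ↦ 0, S₀ ↦ λ; and (PS) for each (λ,z) ∈ k^× × k^×, the 2-dimensional module kv ⊕ kw with vT = zv, vS₁ = w, wS₀ = λv (and wT = zw, vS₀ = 0, wS₁ = 0). There are no isomorphisms between modules with different parameters. -/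
universe v

open MulOpposite

/-- `M` is the one-dimensional "supersingular" module `SS(lam, z)`: the character
`T ↦ z`, `S₁ ↦ 0`, `S₀ ↦ lam`. -/
def SSdata (k : Type*) [Field k] {A : Type*} [Ring A] [Algebra k A] (T S₀ S₁ : A)
    (M : Type v) [AddCommGroup M] [Module k M] [Module Aᵐᵒᵖ M] (lam z : k) : Prop :=
  ∃ e : M ≃ₗ[k] k,
    (∀ m : M, e (op T • m) = z * e m) ∧
    (∀ m : M, e (op S₁ • m) = 0) ∧
    (∀ m : M, e (op S₀ • m) = lam * e m)

/-- `M` is the two-dimensional "principal" module `PS(lam, z)`: basis `v, w` with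
`vT = zv`, `wT = zw`, `vS₁ = w`, `wS₀ = lam·v`, `wS₁ = 0`. -/
def PSdata (k : Type*) [Field k] {A : Type*} [Ring A] [Algebra k A] (T S₀ S₁ : A)
    (M : Type v) [AddCommGroup M] [Module k M] [Module Aᵐᵒᵖ M] (lam z : k) : Prop :=
  ∃ v w : M,
    LinearIndependent k ![v, w] ∧ Submodule.span k {v, w} = (⊤ : Submodule k M) ∧
    op T • v = z • v ∧ op T • w = z • w ∧
    op S₁ • v = w ∧ op S₀ • w = lam • v ∧ op S₁ • w = 0

section helpers
theorem aux_gen {k : Type*} [Field k] {A : Type*} [Ring A] [Algebra k A]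
    (S₀ S₁ : A) (Tu : Aˣ)
    (f : ℤ ⊕ ℤ × ℕ × Fin 4 → A)
    (hfT : ∀ n : ℤ, f (Sum.inl n) = ((Tu ^ n : Aˣ) : A))
    (hf0 : ∀ (n : ℤ) (m : ℕ), f (Sum.inr (n, m, 0)) = ((Tu ^ n : Aˣ) : A) * (S₀ * S₁) ^ (m + 1))
    (hf1 : ∀ (n : ℤ) (m : ℕ), f (Sum.inr (n, m, 1)) = ((Tu ^ n : Aˣ) : A) * (S₁ * S₀) ^ (m + 1))
    (hf2 : ∀ (n : ℤ) (m : ℕ), f (Sum.inr (n, m, 2)) = ((Tu ^ n : Aˣ) : A) * (S₀ * S₁) ^ m * S₀)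
    (hf3 : ∀ (n : ℤ) (m : ℕ), f (Sum.inr (n, m, 3)) = ((Tu ^ n : Aˣ) : A) * (S₁ * S₀) ^ m * S₁)
    (hspan : Submodule.span k (Set.range f) = ⊤)
    (B : Subalgebra k A) (h1 : (Tu : A) ∈ B) (h2 : ((Tu⁻¹ : Aˣ) : A) ∈ B)
    (h3 : S₀ ∈ B) (h4 : S₁ ∈ B) (a : A) : a ∈ B := by
  have hT : ∀ n : ℤ, ((Tu ^ n : Aˣ) : A) ∈ B := by
    intro n
    obtain ⟨m, rfl | rfl⟩ := n.eq_nat_or_neg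
    · simpa using pow_mem h1 m
    · have := pow_mem h2 m
      rwa [zpow_neg, zpow_natCast, ← inv_pow, Units.val_pow_eq_pow_val]
  have hle : Submodule.span k (Set.range f) ≤ Subalgebra.toSubmodule B := by
    rw [Submodule.span_le]
    rintro _ ⟨i, rfl⟩
    rcases i with n | ⟨n, m, j⟩
    · rw [hfT]; exact hT n
    · fin_cases j
      · have h : f (Sum.inr (n, m, 0)) ∈ B := by
          rw [hf0]
          exact mul_mem (hT n) (pow_mem (mul_mem h3 h4) _)
        exact h
      · have h : f (Sum.inr (n, m, 1)) ∈ B := by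
          rw [hf1]
          exact mul_mem (hT n) (pow_mem (mul_mem h4 h3) _)
        exact h
      · have h : f (Sum.inr (n, m, 2)) ∈ B := by
          rw [hf2]
          exact mul_mem (mul_mem (hT n) (pow_mem (mul_mem h3 h4) _)) h3
        exact h
      · have h : f (Sum.inr (n, m, 3)) ∈ B := by
          rw [hf3]
          exact mul_mem (mul_mem (hT n) (pow_mem (mul_mem h4 h3) _)) h4
        exact h
  rw [hspan] at hle
  exact hle (Submodule.mem_top (x := a))

/-- The subalgebra of elements stabilizing a `k`-subspace. -/
def auxStab {k : Type*} [Field k] {A : Type*} [Ring A] [Algebra k A]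
    {M : Type*} [AddCommGroup M] [Module k M] [Module Aᵐᵒᵖ M] [IsScalarTower k Aᵐᵒᵖ M]
    (N : Submodule k M) : Subalgebra k A where
  carrier := {a | ∀ m ∈ N, op a • m ∈ N}
  mul_mem' := by
    intro a b ha hb m hm
    rw [op_mul, mul_smul]
    exact hb _ (ha _ hm)
  add_mem' := by
    intro a b ha hb m hm
    rw [op_add, add_smul]
    exact add_mem (ha _ hm) (hb _ hm)
  algebraMap_mem' := by
    intro c m hm
    rw [Algebra.algebraMap_eq_smul_one, op_smul, op_one, smul_assoc, one_smul]
    exact N.smul_mem c hm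

theorem aux_null {k : Type*} [Field k] [IsAlgClosed k] {M : Type*} [AddCommGroup M]
    [Nontrivial M] [Module (MvPolynomial (Fin 3) k) M] [Module.Finite (MvPolynomial (Fin 3) k) M] :
    ∃ x : Fin 3 → k, ∀ i, ¬ Function.Surjective
      (fun m : M => (MvPolynomial.X i - MvPolynomial.C (x i) : MvPolynomial (Fin 3) k) • m) := by
  obtain ⟨N, hN, -⟩ := (eq_top_or_exists_le_coatom
    (⊥ : Submodule (MvPolynomial (Fin 3) k) M)).resolve_left bot_ne_top
  have : IsSimpleModule (MvPolynomial (Fin 3) k) (M ⧸ N) := isSimpleModule_iff_isCoatom.mpr hN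
  have hm := IsSimpleModule.annihilator_isMaximal (R := MvPolynomial (Fin 3) k) (M := M ⧸ N)
  obtain ⟨x, hx⟩ := MvPolynomial.isMaximal_iff_eq_vanishingIdeal_singleton.mp hm
  refine ⟨x, fun i hs => hN.1 ?_⟩
  rw [eq_top_iff]
  rintro m -
  obtain ⟨m', rfl⟩ := hs m
  have h : (MvPolynomial.X i - MvPolynomial.C (x i) : MvPolynomial (Fin 3) k) ∈
      Module.annihilator (MvPolynomial (Fin 3) k) (M ⧸ N) := by
    rw [hx, MvPolynomial.mem_vanishingIdeal_singleton_iff]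
    simp
  have := Module.mem_annihilator.mp h (Submodule.Quotient.mk m')
  rw [← Submodule.Quotient.mk_smul] at this
  exact (Submodule.Quotient.mk_eq_zero _).mp this

/-- Scalar action of central elements on a simple module. -/
theorem aux_scalar {k : Type*} [Field k] [IsAlgClosed k] {A : Type*} [Ring A] [Algebra k A]
    (T S₀ S₁ Ti Z : A) (hZ : Z = S₀ * S₁ + S₁ * S₀ + S₁)
    (hS0 : S₀ * S₀ = -S₀) (hS1 : S₁ * S₁ = 0)
    (hgen : ∀ B : Subalgebra k A, T ∈ B → Ti ∈ B → S₀ ∈ B → S₁ ∈ B → ∀ a, a ∈ B)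
    (cT : ∀ a, T * a = a * T) (cTi : ∀ a, Ti * a = a * Ti) (cZ : ∀ a, Z * a = a * Z)
    (M : Type*) [AddCommGroup M] [Module k M] [Module Aᵐᵒᵖ M] [IsScalarTower k Aᵐᵒᵖ M]
    [IsSimpleModule Aᵐᵒᵖ M] :
    ∃ c z : k, (∀ m : M, op Z • m = c • m) ∧ (∀ m : M, op T • m = z • m) := by
  have toC : ∀ a : A, (∀ b, a * b = b * a) → op a ∈ Subalgebra.center k Aᵐᵒᵖ := by
    intro a ha
    rw [Subalgebra.mem_center_iff]
    intro b
    apply unop_injective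
    simp [ha]
  let g : Fin 3 → Subalgebra.center k Aᵐᵒᵖ :=
    ![⟨op Z, toC Z cZ⟩, ⟨op T, toC T cT⟩, ⟨op Ti, toC Ti cTi⟩]
  let φ : MvPolynomial (Fin 3) k →ₐ[k] Subalgebra.center k Aᵐᵒᵖ := MvPolynomial.aeval g
  let _ : Module (MvPolynomial (Fin 3) k) M := Module.compHom M φ.toRingHom
  have hsm : ∀ (r : MvPolynomial (Fin 3) k) (m : M), r • m = ((φ r : Subalgebra.center k Aᵐᵒᵖ) : Aᵐᵒᵖ) • m :=
    fun r m => rfl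
  have hX : ∀ i (m : M), (MvPolynomial.X i : MvPolynomial (Fin 3) k) • m = ((g i : Subalgebra.center k Aᵐᵒᵖ) : Aᵐᵒᵖ) • m := by
    intro i m
    rw [hsm]; simp [φ]
  have hC : ∀ (c : k) (m : M), (MvPolynomial.C c : MvPolynomial (Fin 3) k) • m = c • m := by
    intro c m
    rw [hsm, ← MvPolynomial.algebraMap_eq, AlgHom.commutes]
    rw [Subalgebra.coe_algebraMap, algebraMap_smul]
  have : IsScalarTower k (MvPolynomial (Fin 3) k) M := by
    refine ⟨fun c r m => ?_⟩
    rw [hsm, hsm, map_smul, Subalgebra.coe_smul, smul_assoc]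
  have hcomm : ∀ (r : MvPolynomial (Fin 3) k) (a : A) (m : M), op a • r • m = r • op a • m := by
    intro r a m
    rw [hsm, hsm, ← mul_smul, ← mul_smul, (Subalgebra.mem_center_iff.mp (φ r).2 (op a))]
  have hnt : Nontrivial M := IsSimpleModule.nontrivial Aᵐᵒᵖ M
  obtain ⟨x, hx⟩ := exists_ne (0 : M)
  let s : Finset M := by
    classical
    exact {x, op S₀ • x, op S₁ • x, op S₁ • op S₀ • x}
  let N : Submodule (MvPolynomial (Fin 3) k) M := Submodule.span _ (s : Set M)
  have hs : (s : Set M) = {x, op S₀ • x, op S₁ • x, op S₁ • op S₀ • x} := by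
    classical
    simp [s]
  have e0 : ∀ m : M, op S₀ • op S₀ • m = - op S₀ • m := by
    intro m
    rw [← mul_smul, ← op_mul, hS0, op_neg]
  have e1 : ∀ m : M, op S₁ • op S₁ • m = 0 := by
    intro m
    rw [← mul_smul, ← op_mul, hS1, op_zero, zero_smul]
  have eZ : ∀ m : M, op Z • m = op S₁ • op S₀ • m + op S₀ • op S₁ • m + op S₁ • m := by
    intro m
    rw [hZ, op_add, op_add, op_mul, op_mul, add_smul, add_smul, mul_smul, mul_smul]
  have e2 : ∀ m : M, op S₀ • op S₁ • m = op Z • m - op S₁ • op S₀ • m - op S₁ • m := by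
    intro m
    rw [eZ]; abel
  have hZN : ∀ m ∈ N, op Z • m ∈ N := fun m hm => (hX 0 m) ▸ N.smul_mem _ hm
  have m1 : x ∈ N := Submodule.subset_span (by rw [hs]; simp)
  have m2 : op S₀ • x ∈ N := Submodule.subset_span (by rw [hs]; simp)
  have m3 : op S₁ • x ∈ N := Submodule.subset_span (by rw [hs]; simp)
  have m4 : op S₁ • op S₀ • x ∈ N := Submodule.subset_span (by rw [hs]; simp)
  have lift : ∀ a : A, (∀ m ∈ (s : Set M), op a • m ∈ N) → ∀ m ∈ N, op a • m ∈ N := by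
    intro a ha m hm
    induction hm using Submodule.span_induction with
    | mem m h => exact ha m h
    | zero => rw [smul_zero]; exact N.zero_mem
    | add y z _ _ hy hz => rw [smul_add]; exact N.add_mem hy hz
    | smul r y _ hy => rw [hcomm]; exact N.smul_mem r hy
  have hall : ∀ a : A, ∀ m ∈ N, op a • m ∈ N := by
    intro a
    refine hgen (auxStab (N.restrictScalars k)) ?_ ?_ ?_ ?_ a
    · exact fun m hm => (hX 1 m) ▸ N.smul_mem _ hm
    · exact fun m hm => (hX 2 m) ▸ N.smul_mem _ hm
    · refine lift S₀ ?_
      rw [hs]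
      rintro m (rfl | rfl | rfl | rfl)
      · exact m2
      · rw [e0, neg_smul]; exact N.neg_mem m2
      · rw [e2]; exact N.sub_mem (N.sub_mem (hZN _ m1) m4) m3
      · rw [e2, e0, neg_smul, smul_neg, sub_neg_eq_add, add_sub_cancel_right]
        exact hZN _ m2
    · refine lift S₁ ?_
      rw [hs]
      rintro m (rfl | rfl | rfl | rfl)
      · exact m3
      · exact m4
      · rw [e1]; exact N.zero_mem
      · rw [e1]; exact N.zero_mem
  let N' : Submodule Aᵐᵒᵖ M :=
    { carrier := N
      add_mem' := fun h h' => N.add_mem h h'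
      zero_mem' := N.zero_mem
      smul_mem' := fun a m hm => hall (unop a) m hm }
  have hN' : N' = ⊤ := by
    refine (eq_bot_or_eq_top N').resolve_left fun h => hx ?_
    have : x ∈ N' := m1
    rwa [h, Submodule.mem_bot] at this
  have hN : N = ⊤ := by
    rw [eq_top_iff]
    rintro m -
    have : m ∈ N' := hN' ▸ Submodule.mem_top
    exact this
  have : Module.Finite (MvPolynomial (Fin 3) k) M := ⟨⟨s, hN⟩⟩
  obtain ⟨y, hy⟩ := aux_null (k := k) (M := M)
  have key : ∀ i (m : M), ((g i : Subalgebra.center k Aᵐᵒᵖ) : Aᵐᵒᵖ) • m = y i • m := by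
    intro i
    let L : M →ₗ[Aᵐᵒᵖ] M :=
      { toFun := fun m => (MvPolynomial.X i - MvPolynomial.C (y i) : MvPolynomial (Fin 3) k) • m
        map_add' := fun a b => smul_add _ a b
        map_smul' := fun a m => (hcomm _ (unop a) m).symm }
    have hL : L = 0 := (LinearMap.surjective_or_eq_zero L).resolve_left (hy i)
    intro m
    have : L m = 0 := by rw [hL]; rfl
    change (MvPolynomial.X i - MvPolynomial.C (y i) : MvPolynomial (Fin 3) k) • m = 0 at this
    rwa [sub_smul, hX, hC, sub_eq_zero] at this
  exact ⟨y 0, y 1, key 0, key 1⟩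

end helpers

/-- Classification of the simple right modules of the algebra `H(1)` (abstractly: a `k`-algebra
with central invertible `T` and `S₀, S₁` with `S₀² = -S₀`, `S₁² = 0` and the standard basis):
they are exactly the characters `SS(lam,z)` with `lam ∈ {0,-1}`, `z ∈ k^×`, and the
2-dimensional modules `PS(lam,z)` with `lam, z ∈ k^×`, with no isomorphisms between modules
associated to different parameters. -/
theorem statement9 (k : Type*) [Field k] [IsAlgClosed k] (p : ℕ) [Fact p.Prime] [CharP k p]
    (hp : Odd p)
    (A : Type*) [Ring A] [Algebra k A]
    (T S₀ S₁ : A) (Tu : Aˣ) (hTu : (Tu : A) = T)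
    (hTcen : ∀ a : A, T * a = a * T)
    (hS0 : S₀ * S₀ = -S₀) (hS1 : S₁ * S₁ = 0)
    (f : ℤ ⊕ ℤ × ℕ × Fin 4 → A)
    (hfT : ∀ n : ℤ, f (Sum.inl n) = ((Tu ^ n : Aˣ) : A))
    (hf0 : ∀ (n : ℤ) (m : ℕ), f (Sum.inr (n, m, 0)) = ((Tu ^ n : Aˣ) : A) * (S₀ * S₁) ^ (m + 1))
    (hf1 : ∀ (n : ℤ) (m : ℕ), f (Sum.inr (n, m, 1)) = ((Tu ^ n : Aˣ) : A) * (S₁ * S₀) ^ (m + 1))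
    (hf2 : ∀ (n : ℤ) (m : ℕ), f (Sum.inr (n, m, 2)) = ((Tu ^ n : Aˣ) : A) * (S₀ * S₁) ^ m * S₀)
    (hf3 : ∀ (n : ℤ) (m : ℕ), f (Sum.inr (n, m, 3)) = ((Tu ^ n : Aˣ) : A) * (S₁ * S₀) ^ m * S₁)
    (hli : LinearIndependent k f)
    (hspan : Submodule.span k (Set.range f) = ⊤) :
    -- every simple right module is of type SS or PS
    (∀ (M : Type v) [AddCommGroup M] [Module k M] [Module Aᵐᵒᵖ M] [IsScalarTower k Aᵐᵒᵖ M],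
      IsSimpleModule Aᵐᵒᵖ M →
        (∃ lam z : k, (lam = 0 ∨ lam = -1) ∧ z ≠ 0 ∧ SSdata k T S₀ S₁ M lam z) ∨
        (∃ lam z : k, lam ≠ 0 ∧ z ≠ 0 ∧ PSdata k T S₀ S₁ M lam z)) ∧
    -- the SS and PS modules are simple
    (∀ (M : Type v) [AddCommGroup M] [Module k M] [Module Aᵐᵒᵖ M] [IsScalarTower k Aᵐᵒᵖ M]
      (lam z : k), (lam = 0 ∨ lam = -1) → z ≠ 0 → SSdata k T S₀ S₁ M lam z →
        IsSimpleModule Aᵐᵒᵖ M) ∧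
    (∀ (M : Type v) [AddCommGroup M] [Module k M] [Module Aᵐᵒᵖ M] [IsScalarTower k Aᵐᵒᵖ M]
      (lam z : k), lam ≠ 0 → z ≠ 0 → PSdata k T S₀ S₁ M lam z →
        IsSimpleModule Aᵐᵒᵖ M) ∧
    -- no isomorphisms between modules with different parameters
    (∀ (M : Type v) [AddCommGroup M] [Module k M] [Module Aᵐᵒᵖ M] [IsScalarTower k Aᵐᵒᵖ M]
      (lam z lam' z' : k), SSdata k T S₀ S₁ M lam z → SSdata k T S₀ S₁ M lam' z' →
        lam = lam' ∧ z = z') ∧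
    (∀ (M : Type v) [AddCommGroup M] [Module k M] [Module Aᵐᵒᵖ M] [IsScalarTower k Aᵐᵒᵖ M]
      (lam z lam' z' : k), lam ≠ 0 → lam' ≠ 0 → PSdata k T S₀ S₁ M lam z →
        PSdata k T S₀ S₁ M lam' z' → lam = lam' ∧ z = z') ∧
    (∀ (M : Type v) [AddCommGroup M] [Module k M] [Module Aᵐᵒᵖ M] [IsScalarTower k Aᵐᵒᵖ M]
      (lam z lam' z' : k), lam' ≠ 0 → z' ≠ 0 →
        ¬(SSdata k T S₀ S₁ M lam z ∧ PSdata k T S₀ S₁ M lam' z')) := by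
  have eS0 : ∀ (M : Type v) [AddCommGroup M] [Module Aᵐᵒᵖ M] (m : M),
      op S₀ • op S₀ • m = - (op S₀ • m) := by
    intro M _ _ m
    rw [← mul_smul, ← op_mul, hS0, op_neg, neg_smul]
  have eS1 : ∀ (M : Type v) [AddCommGroup M] [Module Aᵐᵒᵖ M] (m : M),
      op S₁ • op S₁ • m = 0 := by
    intro M _ _ m
    rw [← mul_smul, ← op_mul, hS1, op_zero, zero_smul]
  have hv : ∀ (M : Type v) [AddCommGroup M] [Module k M] [Module Aᵐᵒᵖ M] [IsScalarTower k Aᵐᵒᵖ M]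
      (lam : k) (v w : M), lam ≠ 0 → op S₀ • w = lam • v → op S₀ • v = -v := by
    intro M _ _ _ _ lam v w hl h
    have h1 := eS0 M w
    rw [h, smul_comm, ← smul_neg] at h1
    exact smul_right_injective M hl h1
  refine ⟨?_, ?_, ?_, ?_, ?_, ?_⟩
  · intro M _ _ _ _ hsimple
    have hgen := aux_gen (k := k) S₀ S₁ Tu f hfT hf0 hf1 hf2 hf3 hspan
    have cTi : ∀ a, ((Tu⁻¹ : Aˣ) : A) * a = a * ((Tu⁻¹ : Aˣ) : A) := by
      intro a
      have : Commute (Tu : A) a := by rw [hTu]; exact hTcen a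
      exact this.units_inv_left
    have cZ : ∀ a, (S₀ * S₁ + S₁ * S₀ + S₁) * a = a * (S₀ * S₁ + S₁ * S₀ + S₁) := by
      intro a
      have := hgen (Subalgebra.centralizer k {S₀ * S₁ + S₁ * S₀ + S₁}) ?_ ?_ ?_ ?_ a
      · exact Subalgebra.mem_centralizer_iff k |>.mp this _ rfl
      all_goals
        rw [Subalgebra.mem_centralizer_iff]
        rintro _ rfl
      · rw [hTu]; exact (hTcen _).symm
      · exact (cTi _).symm
      · simp only [add_mul, mul_add, mul_assoc, hS0]
        simp only [← mul_assoc, hS0]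
        simp only [mul_neg, neg_mul]
        abel
      · simp only [add_mul, mul_add, mul_assoc, hS1]
        simp only [← mul_assoc, hS1]
        simp
    obtain ⟨c, z, hc, hz⟩ := aux_scalar (k := k) T S₀ S₁ ((Tu⁻¹ : Aˣ) : A) _ rfl hS0 hS1
      (fun B h1 => hgen B (hTu ▸ h1)) hTcen cTi cZ M
    have hnt : Nontrivial M := IsSimpleModule.nontrivial Aᵐᵒᵖ M
    have hz0 : z ≠ 0 := by
      rintro rfl
      obtain ⟨x, hx⟩ := exists_ne (0 : M)
      apply hx
      have := hz (op ((Tu⁻¹ : Aˣ) : A) • x)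
      rw [zero_smul, ← mul_smul, ← op_mul, ← hTu, Units.inv_mul, op_one, one_smul] at this
      exact this
    have hTi : ∀ m : M, op ((Tu⁻¹ : Aˣ) : A) • m = z⁻¹ • m := by
      intro m
      have := hz (op ((Tu⁻¹ : Aˣ) : A) • m)
      rw [← mul_smul, ← op_mul, ← hTu, Units.inv_mul, op_one, one_smul] at this
      rw [eq_inv_smul_iff₀ hz0]
      exact this.symm
    have htop : ∀ (N : Submodule k M), (∃ x ∈ N, x ≠ 0) → (∀ m ∈ N, op S₀ • m ∈ N) →
        (∀ m ∈ N, op S₁ • m ∈ N) → N = ⊤ := by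
      rintro N ⟨x, hxN, hx⟩ h0 h1
      have hall := hgen (auxStab N) (fun m hm => by rw [hTu, hz]; exact N.smul_mem _ hm)
        (fun m hm => by rw [hTi]; exact N.smul_mem _ hm) h0 h1
      let N' : Submodule Aᵐᵒᵖ M :=
        { carrier := N
          add_mem' := fun h h' => N.add_mem h h'
          zero_mem' := N.zero_mem
          smul_mem' := fun a m hm => hall (unop a) m hm }
      have hN' : N' = ⊤ := by
        refine (eq_bot_or_eq_top N').resolve_left fun h => hx ?_
        have : x ∈ N' := hxN
        rwa [h, Submodule.mem_bot] at this
      rw [eq_top_iff]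
      rintro m -
      have : m ∈ N' := hN' ▸ Submodule.mem_top
      exact this
    have hcZ : ∀ m : M, op S₁ • op S₀ • m + op S₀ • op S₁ • m + op S₁ • m = c • m := by
      intro m
      rw [← hc, op_add, op_add, op_mul, op_mul, add_smul, add_smul, mul_smul, mul_smul]
    by_cases hS : ∀ m : M, op S₁ • m = 0
    · left
      have main : ∃ (x : M) (lam : k), x ≠ 0 ∧ (lam = 0 ∨ lam = -1) ∧ op S₀ • x = lam • x := by
        by_cases h : ∀ m : M, op S₀ • m = 0
        · obtain ⟨x, hx⟩ := exists_ne (0 : M)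
          exact ⟨x, 0, hx, Or.inl rfl, by rw [h, zero_smul]⟩
        · push Not at h
          obtain ⟨x, hx⟩ := h
          exact ⟨op S₀ • x, -1, hx, Or.inr rfl, by rw [eS0, neg_one_smul]⟩
      obtain ⟨x, lam, hx, hlam, hxl⟩ := main
      have hsp : Submodule.span k {x} = ⊤ := by
        refine htop _ ⟨x, Submodule.mem_span_singleton_self x, hx⟩ ?_ ?_
        · intro m hm
          obtain ⟨a, rfl⟩ := Submodule.mem_span_singleton.mp hm
          rw [smul_comm, hxl, smul_smul]
          exact Submodule.smul_mem _ _ (Submodule.mem_span_singleton_self x)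
        · intro m _
          rw [hS]; exact Submodule.zero_mem _
      have h0 : ∀ m : M, op S₀ • m = lam • m := by
        intro m
        have hm : m ∈ Submodule.span k {x} := hsp ▸ Submodule.mem_top
        obtain ⟨a, rfl⟩ := Submodule.mem_span_singleton.mp hm
        rw [smul_comm, hxl, smul_comm]
      let e : M ≃ₗ[k] k := ((LinearEquiv.toSpanNonzeroSingleton k M x hx).trans
        (LinearEquiv.ofTop _ hsp)).symm
      refine ⟨lam, z, hlam, hz0, e, ?_, ?_, ?_⟩
      · intro m; rw [hz, map_smul, smul_eq_mul]
      · intro m; rw [hS, map_zero]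
      · intro m; rw [h0, map_smul, smul_eq_mul]
    · right
      push Not at hS
      obtain ⟨x, hx⟩ := hS
      obtain ⟨w, hw⟩ : ∃ w, w = op S₁ • x := ⟨_, rfl⟩
      have hw0 : w ≠ 0 := hw ▸ hx
      have hw1 : op S₁ • w = 0 := by rw [hw, eS1]
      have hu : op S₁ • op S₀ • w = c • w := by
        have := hcZ w
        rwa [hw1, smul_zero, add_zero, add_zero] at this
      have hsp : Submodule.span k {op S₀ • w, w} = ⊤ := by
        refine htop _ ⟨w, Submodule.subset_span (by simp), hw0⟩ ?_ ?_
        · intro m hm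
          obtain ⟨a, b, rfl⟩ := Submodule.mem_span_pair.mp hm
          rw [smul_add, smul_comm, smul_comm (op S₀) b, eS0]
          exact Submodule.mem_span_pair.mpr ⟨-a + b, 0, by
            generalize op S₀ • w = u
            module⟩
        · intro m hm
          obtain ⟨a, b, rfl⟩ := Submodule.mem_span_pair.mp hm
          rw [smul_add, smul_comm, smul_comm (op S₁) b, hu, hw1]
          exact Submodule.mem_span_pair.mpr ⟨0, a * c, by
            generalize op S₀ • w = u
            module⟩
      have hc0 : c ≠ 0 := by
        rintro rfl
        have hxm : x ∈ Submodule.span k {op S₀ • w, w} := hsp ▸ Submodule.mem_top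
        obtain ⟨a, b, rfl⟩ := Submodule.mem_span_pair.mp hxm
        apply hx
        rw [smul_add, smul_comm, smul_comm (op S₁) b, hu, hw1]
        simp
      have hv1 : op S₁ • (c⁻¹ • op S₀ • w) = w := by
        rw [smul_comm, hu, inv_smul_smul₀ hc0]
      refine ⟨c, z, hc0, hz0, c⁻¹ • op S₀ • w, w, ?_, ?_, hz _, hz _, hv1, ?_, hw1⟩
      · rw [LinearIndependent.pair_iff]
        intro a b hab
        have h := congrArg (fun m => op S₁ • m) hab
        simp only [smul_add, smul_zero] at h
        rw [smul_comm, hv1, smul_comm (op S₁) b, hw1, smul_zero, add_zero] at h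
        have ha : a = 0 := (smul_eq_zero.mp h).resolve_right hw0
        subst ha
        rw [zero_smul, zero_add] at hab
        exact ⟨rfl, (smul_eq_zero.mp hab).resolve_right hw0⟩
      · rw [eq_top_iff, ← hsp, Submodule.span_le]
        rintro m (rfl | rfl)
        · exact Submodule.mem_span_pair.mpr ⟨c, 0, by
            rw [smul_inv_smul₀ hc0, zero_smul, add_zero]⟩
        · exact Submodule.subset_span (by simp)
      · rw [smul_inv_smul₀ hc0]
  · rintro M _ _ _ _ lam z - - ⟨e, -, -, -⟩
    have : Nontrivial M := e.toEquiv.nontrivial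
    refine { toNontrivial := inferInstance, eq_bot_or_eq_top := fun N => ?_ }
    by_cases hN : N = ⊥
    · exact Or.inl hN
    right
    obtain ⟨x, hxN, hx⟩ := Submodule.exists_mem_ne_zero_of_ne_bot hN
    rw [eq_top_iff]
    rintro m -
    have hex : e x ≠ 0 := fun h => hx (e.map_eq_zero_iff.mp h)
    have : m = (e m * (e x)⁻¹) • x := by
      apply e.injective
      rw [map_smul, smul_eq_mul, inv_mul_cancel_right₀ hex]
    rw [this]
    exact (N.restrictScalars k).smul_mem _ hxN
  · rintro M _ _ _ _ lam z hl - ⟨v, w, hli, hsp, -, -, hvw, hwv, hw⟩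
    have hv0 : v ≠ 0 := hli.ne_zero 0
    have : Nontrivial M := ⟨v, 0, hv0⟩
    refine { toNontrivial := inferInstance, eq_bot_or_eq_top := fun N => ?_ }
    by_cases hN : N = ⊥
    · exact Or.inl hN
    right
    have hwt : w ∈ N → N = ⊤ := by
      intro h
      have hvN : v ∈ N := by
        have h1 := N.smul_mem (op S₀) h
        rw [hwv] at h1
        have := (N.restrictScalars k).smul_mem lam⁻¹ h1
        rwa [inv_smul_smul₀ hl] at this
      rw [eq_top_iff]
      rintro m -
      have hm : m ∈ Submodule.span k {v, w} := hsp ▸ Submodule.mem_top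
      obtain ⟨a, b, rfl⟩ := Submodule.mem_span_pair.mp hm
      exact N.add_mem ((N.restrictScalars k).smul_mem a hvN) ((N.restrictScalars k).smul_mem b h)
    have hsw : ∀ a : k, a ≠ 0 → a • w ∈ N → N = ⊤ := by
      intro a ha h
      have := (N.restrictScalars k).smul_mem a⁻¹ h
      rw [inv_smul_smul₀ ha] at this
      exact hwt this
    obtain ⟨x, hxN, hx⟩ := Submodule.exists_mem_ne_zero_of_ne_bot hN
    have hm : x ∈ Submodule.span k {v, w} := hsp ▸ Submodule.mem_top
    obtain ⟨a, b, rfl⟩ := Submodule.mem_span_pair.mp hm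
    by_cases ha : a = 0
    · subst ha
      rw [zero_smul, zero_add] at hxN hx
      exact hsw b (fun h => hx (by rw [h, zero_smul])) hxN
    · have := N.smul_mem (op S₁) hxN
      rw [smul_add, smul_comm, hvw, smul_comm (op S₁) b, hw, smul_zero, add_zero] at this
      exact hsw a ha this
  · rintro M _ _ _ _ lam z lam' z' ⟨e, h1, -, h2⟩ ⟨e', h1', -, h2'⟩
    obtain ⟨x, hx⟩ : ∃ x, e x = 1 := ⟨e.symm 1, e.apply_symm_apply 1⟩
    have hx0 : x ≠ 0 := by
      rintro rfl
      rw [map_zero] at hx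
      exact zero_ne_one hx
    have a1 : op S₀ • x = lam • x := e.injective (by rw [h2, map_smul, smul_eq_mul])
    have a2 : op S₀ • x = lam' • x := e'.injective (by rw [h2', map_smul, smul_eq_mul])
    have b1 : op T • x = z • x := e.injective (by rw [h1, map_smul, smul_eq_mul])
    have b2 : op T • x = z' • x := e'.injective (by rw [h1', map_smul, smul_eq_mul])
    exact ⟨smul_left_injective k hx0 (a1.symm.trans a2), smul_left_injective k hx0 (b1.symm.trans b2)⟩
  · intro M _ _ _ _ lam z lam' z' hl hl' hP hP'
    have key : ∀ lam z : k, lam ≠ 0 → PSdata k T S₀ S₁ M lam z →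
        (∀ m : M, op S₁ • op S₀ • m + op S₀ • op S₁ • m + op S₁ • m = lam • m) ∧
        (∀ m : M, op T • m = z • m) := by
      rintro lam z hl ⟨v, w, -, hsp, hTv, hTw, hvw, hwv, hw⟩
      have hv' := hv M lam v w hl hwv
      constructor
      · intro m
        have hm : m ∈ Submodule.span k {v, w} := hsp ▸ Submodule.mem_top
        obtain ⟨a, b, rfl⟩ := Submodule.mem_span_pair.mp hm
        simp only [smul_add, smul_comm _ a, smul_comm _ b, hv', hwv, hvw, hw, smul_neg, smul_zero]
        simp only [smul_comm _ lam, hvw]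
        module
      · intro m
        have hm : m ∈ Submodule.span k {v, w} := hsp ▸ Submodule.mem_top
        obtain ⟨a, b, rfl⟩ := Submodule.mem_span_pair.mp hm
        rw [smul_add, smul_comm, smul_comm (op T) b, hTv, hTw]
        module
    obtain ⟨a1, b1⟩ := key lam z hl hP
    obtain ⟨a2, b2⟩ := key lam' z' hl' hP'
    obtain ⟨v, w, hli, -⟩ := hP
    have hv0 : v ≠ 0 := hli.ne_zero 0
    exact ⟨smul_left_injective k hv0 ((a1 v).symm.trans (a2 v)),
      smul_left_injective k hv0 ((b1 v).symm.trans (b2 v))⟩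
  · rintro M _ _ _ _ lam z lam' z' - - ⟨⟨e, -, h, -⟩, ⟨v, w, hli, -, -, -, hvw, -, -⟩⟩
    have hw0 : w ≠ 0 := hli.ne_zero 1
    apply hw0
    rw [← hvw]
    exact e.map_eq_zero_iff.mp (h v)
end
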